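/- (Quasisymmetric linearization of analytic circle maps of bounded type, the analytic case of the paper's Hérman–Swiatek type theorem.) Let F : ℝ → ℝ be real-analytic, strictly increasing, with F(x+1) = F(x) + 1 for all x (a lift of an orientation-preserving analytic circle homeomorphism, critical points allowed), and let θ = lim_{n→∞} Fⁿ(x)/n be its rotation number. Assume θ is of bounded type, i.e. there exists c > 0 such that |θ − p/q| ≥ c/q² for every integer p and every positive integer q. Then F is quasisymmetrically conjugate to the rigid rotation by θ: there exist an increasing homeomorphism h : ℝ → ℝ with h(x+1) = h(x) + 1 and h(F(x)) = h(x) + θ for all x ∈ ℝ, and a constant H ≥ 1 such that H⁻¹ ≤ (h(x+t) − h(x)) / (h(x) − h(x−t)) ≤ H for all x ∈ ℝ and all t > 0. -/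

import Mathlib

lemma tp_geom (m : ℕ) (a b c d : ℝ) (ha : 0 ≤ a) (hb : 0 ≤ b) (had : a ≤ d) (hbc : b ≤ c) :
    (∑ i ∈ Finset.range m, a^i * b^(m-1-i)) * (∑ i ∈ Finset.range m, d^i * c^(m-1-i)) ≤
    (∑ i ∈ Finset.range m, a^i * c^(m-1-i)) * (∑ i ∈ Finset.range m, d^i * b^(m-1-i)) := by
  have key : ∀ i < m, ∀ j < m,
      (a^i*b^(m-1-i))*(d^j*c^(m-1-j)) + (a^j*b^(m-1-j))*(d^i*c^(m-1-i)) ≤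
      (a^i*c^(m-1-i))*(d^j*b^(m-1-j)) + (a^j*c^(m-1-j))*(d^i*b^(m-1-i)) := by
    have main : ∀ i j : ℕ, i ≤ j → j < m → 
      (a^i*b^(m-1-i))*(d^j*c^(m-1-j)) + (a^j*b^(m-1-j))*(d^i*c^(m-1-i)) ≤
      (a^i*c^(m-1-i))*(d^j*b^(m-1-j)) + (a^j*c^(m-1-j))*(d^i*b^(m-1-i)) := by
      intro i j hij hj
      obtain ⟨k, rfl⟩ := Nat.exists_eq_add_of_le hij
      obtain ⟨l, hl⟩ : ∃ l, m - 1 - (i+k) = l := ⟨_, rfl⟩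
      have h2 : m - 1 - i = l + k := by omega
      rw [hl, h2]
      simp only [pow_add]
      have e1 : a^k ≤ d^k := pow_le_pow_left₀ ha had k
      have e2 : b^k ≤ c^k := pow_le_pow_left₀ hb hbc k
      have hd : 0 ≤ d := ha.trans had
      have hc : 0 ≤ c := hb.trans hbc
      have e3 : 0 ≤ (a^i*d^i*(b^l*c^l)) * ((d^k - a^k)*(c^k-b^k)) :=
        mul_nonneg (by positivity) (mul_nonneg (by linarith) (by linarith))
      nlinarith [e3]
    intro i hi j hj
    rcases le_total i j with h | h
    · exact main i j h hj
    · have := main j i h hi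
      linarith
  rw [Finset.sum_mul_sum, Finset.sum_mul_sum]
  have h1 : ∀ f : ℕ → ℕ → ℝ, 2 * ∑ i ∈ Finset.range m, ∑ j ∈ Finset.range m, f i j =
      ∑ i ∈ Finset.range m, ∑ j ∈ Finset.range m, (f i j + f j i) := by
    intro f
    simp only [Finset.sum_add_distrib]
    rw [Finset.sum_comm (f := fun i j => f j i)]
    ring
  have h2 : 2 * ∑ i ∈ Finset.range m, ∑ j ∈ Finset.range m, (a^i*b^(m-1-i))*(d^j*c^(m-1-j)) ≤
      2 * ∑ i ∈ Finset.range m, ∑ j ∈ Finset.range m, (a^i*c^(m-1-i))*(d^j*b^(m-1-j)) := by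
    rw [h1, h1]
    refine Finset.sum_le_sum fun i hi => Finset.sum_le_sum fun j hj => ?_
    exact key i (Finset.mem_range.1 hi) j (Finset.mem_range.1 hj)
  linarith

/-- cross-ratio inequality with constant `C` -/
def CRI (F : ℝ → ℝ) (C a b c d : ℝ) : Prop :=
  (F b - F a) * (F d - F c) * ((c - a) * (d - b)) ≤
    C * ((F c - F a) * (F d - F b) * ((b - a) * (d - c)))

lemma cri_pow (m : ℕ) (a b c d : ℝ) (ha : 0 ≤ a) (hab : a ≤ b) (hbc : b ≤ c) (hcd : c ≤ d) :
    CRI (fun x => x^m) 1 a b c d := by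
  unfold CRI
  have h := tp_geom m a b c d ha (ha.trans hab) (by linarith) hbc
  have g : ∀ x y : ℝ, y^m - x^m = (∑ i ∈ Finset.range m, x^i * y^(m-1-i)) * (y - x) := by
    intro x y
    have := geom_sum₂_mul x y m
    linarith
  have g' : ∀ x y : ℝ, y^m - x^m = (∑ i ∈ Finset.range m, y^i * x^(m-1-i)) * (y - x) := by
    intro x y
    exact (geom_sum₂_mul y x m).symm
  simp only
  rw [g a b, g a c, g' c d, g' b d]
  have hp : 0 ≤ (b-a)*(d-c)*((c-a)*(d-b)) :=
    mul_nonneg (mul_nonneg (by linarith) (by linarith)) (mul_nonneg (by linarith) (by linarith))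
  nlinarith [mul_le_mul_of_nonneg_right h hp]

lemma cri_compare (F P : ℝ → ℝ) (m M a b c d : ℝ) (hm : 0 < m) (hab : a ≤ b) (hbc : b ≤ c)
    (hcd : c ≤ d) (hP : ∀ x ∈ Set.Icc a d, ∀ y ∈ Set.Icc a d, x ≤ y → P x ≤ P y) (hmM : m ≤ M)
    (h1 : ∀ x ∈ Set.Icc a d, ∀ y ∈ Set.Icc a d, x ≤ y → m * (P y - P x) ≤ F y - F x)
    (h2 : ∀ x ∈ Set.Icc a d, ∀ y ∈ Set.Icc a d, x ≤ y → F y - F x ≤ M * (P y - P x))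
    (hc : CRI P 1 a b c d) : CRI F ((M/m)^2) a b c d := by
  unfold CRI at *
  have ia : a ∈ Set.Icc a d := ⟨le_refl _, by linarith⟩
  have ib : b ∈ Set.Icc a d := ⟨by linarith, by linarith⟩
  have ic : c ∈ Set.Icc a d := ⟨by linarith, by linarith⟩
  have id : d ∈ Set.Icc a d := ⟨by linarith, by linarith⟩
  have pab := hP a ia b ib hab
  have pac := hP a ia c ic (by linarith)
  have pcd := hP c ic d id hcd
  have pbd := hP b ib d id (by linarith)
  have hM : 0 < M := hm.trans_le hmM
  have A1 : (F b - F a) * (F d - F c) ≤ (M * (P b - P a)) * (M * (P d - P c)) := by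
    apply mul_le_mul (h2 a ia b ib hab) (h2 c ic d id hcd)
    · exact le_trans (mul_nonneg hm.le (by linarith)) (h1 c ic d id hcd)
    · exact mul_nonneg hM.le (by linarith)
  have A2 : (m * (P c - P a)) * (m * (P d - P b)) ≤ (F c - F a) * (F d - F b) := by
    apply mul_le_mul (h1 a ia c ic (by linarith)) (h1 b ib d id (by linarith))
    · exact mul_nonneg hm.le (by linarith)
    · exact le_trans (mul_nonneg hm.le (by linarith)) (h1 a ia c ic (by linarith))
  have q1 : 0 ≤ (c-a)*(d-b) := mul_nonneg (by linarith) (by linarith)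
  have q2 : 0 ≤ (b-a)*(d-c) := mul_nonneg (by linarith) (by linarith)
  calc _ ≤ (M * (P b - P a)) * (M * (P d - P c)) * ((c-a)*(d-b)) :=
        mul_le_mul_of_nonneg_right A1 q1
    _ = M^2 * ((P b - P a) * (P d - P c) * ((c-a)*(d-b))) := by ring
    _ ≤ M^2 * (1 * ((P c - P a) * (P d - P b) * ((b - a) * (d - c)))) :=
        mul_le_mul_of_nonneg_left hc (by positivity)
    _ = (M/m)^2 * ((m * (P c - P a)) * (m * (P d - P b)) * ((b - a) * (d - c))) := by
        field_simp
    _ ≤ _ := mul_le_mul_of_nonneg_left (mul_le_mul_of_nonneg_right A2 q2) (by positivity)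

lemma diff_le_of_deriv (F G : ℝ → ℝ) (a d : ℝ) (f g : ℝ → ℝ)
    (hF : ∀ x, HasDerivAt F (f x) x) (hG : ∀ x, HasDerivAt G (g x) x)
    (h : ∀ x ∈ Set.Icc a d, f x ≤ g x) :
    ∀ x ∈ Set.Icc a d, ∀ y ∈ Set.Icc a d, x ≤ y → F y - F x ≤ G y - G x := by
  intro x hx y hy hxy
  have hd : ∀ x, HasDerivAt (fun x => G x - F x) (g x - f x) x := fun x => (hG x).sub (hF x)
  have hm : MonotoneOn (fun x => G x - F x) (Set.Icc a d) := by
    apply monotoneOn_of_deriv_nonneg (convex_Icc a d)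
    · exact fun z _ => (hd z).continuousAt.continuousWithinAt
    · exact fun z _ => (hd z).differentiableAt.differentiableWithinAt
    · intro z hz
      rw [(hd z).deriv]
      have := h z (interior_subset hz)
      linarith
  have := hm hx hy hxy
  simp only at this
  linarith

lemma cri_local_good (F u V : ℝ → ℝ) (x0 L : ℝ) (n : ℕ) (hF : ∀ x, HasDerivAt F (u x) x)
    (a b c d : ℝ) (hab : a ≤ b) (hbc : b ≤ c) (hcd : c ≤ d) (hL : 0 ≤ L)
    (hu : ∀ x ∈ Set.Icc a d, u x = |x - x0|^n * Real.exp (V x))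
    (hV : ∀ x ∈ Set.Icc a d, |V x - V a| ≤ L * |x - a|)
    (hx0 : x0 ≤ a ∨ d ≤ x0) : CRI F (Real.exp (4 * L * (d - a))) a b c d := by
  have hV' : ∀ x ∈ Set.Icc a d, |V x - V a| ≤ L * (d - a) := by
    intro x hx
    refine (hV x hx).trans (mul_le_mul_of_nonneg_left ?_ hL)
    rw [abs_of_nonneg (by linarith [hx.1])]
    linarith [hx.2]
  have hP : ∃ P p : ℝ → ℝ, (∀ x, HasDerivAt P (p x) x) ∧
      (∀ x ∈ Set.Icc a d, p x = (n+1) * |x - x0|^n) ∧ CRI P 1 a b c d := by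
    rcases hx0 with h0 | h0
    · refine ⟨fun x => (x - x0)^(n+1), fun x => (n+1) * (x-x0)^n, ?_, ?_, ?_⟩
      · intro x
        have := ((hasDerivAt_id' x).sub_const x0).fun_pow (n+1)
        simpa using this
      · intro x hx
        simp only
        rw [abs_of_nonneg (by linarith [hx.1])]
      · have := cri_pow (n+1) (a-x0) (b-x0) (c-x0) (d-x0) (by linarith) (by linarith)
          (by linarith) (by linarith)
        simpa [CRI] using this
    · refine ⟨fun x => -(x0 - x)^(n+1), fun x => (n+1) * (x0-x)^n, ?_, ?_, ?_⟩
      · intro x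
        have := (((hasDerivAt_id' x).const_sub x0).fun_pow (n+1)).fun_neg
        simpa using this
      · intro x hx
        simp only
        rw [abs_sub_comm, abs_of_nonneg (by linarith [hx.2])]
      · have := cri_pow (n+1) (x0-d) (x0-c) (x0-b) (x0-a) (by linarith) (by linarith)
          (by linarith) (by linarith)
        simp only [CRI] at this ⊢
        ring_nf at this ⊢
        linarith
  obtain ⟨P, p, hPd, hpe, hPc⟩ := hP
  set E := L * (d - a) with hE
  have hn : (0:ℝ) < n + 1 := by positivity
  have hE0 : 0 ≤ E := mul_nonneg hL (by linarith)
  have hPm : ∀ x ∈ Set.Icc a d, ∀ y ∈ Set.Icc a d, x ≤ y → P x ≤ P y := by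
    intro x hx y hy hxy
    have := diff_le_of_deriv (fun _ => 0) P a d (fun _ => 0) p (fun x => hasDerivAt_const x 0) hPd
      (fun x hx => by rw [hpe x hx]; positivity) x hx y hy hxy
    linarith
  have key := cri_compare F P (Real.exp (V a - E) / (n+1)) (Real.exp (V a + E) / (n+1)) a b c d
    (by positivity) hab hbc hcd hPm (by gcongr; linarith) ?_ ?_ hPc
  · convert key using 1
    rw [div_div_div_cancel_right₀ hn.ne', ← Real.exp_sub, ← Real.exp_nat_mul]
    congr 1
    push_cast
    rw [hE]
    ring
  · intro x hx y hy hxy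
    have := diff_le_of_deriv (fun x => (Real.exp (V a - E) / (n+1)) * P x) F a d _ _ 
      (fun x => (hPd x).const_mul _) hF ?_ x hx y hy hxy
    · linarith
    · intro z hz
      rw [hpe z hz, hu z hz]
      have h1 := abs_le.1 (hV' z hz)
      have h2 : Real.exp (V a - E) ≤ Real.exp (V z) := Real.exp_le_exp.2 (by linarith)
      have h3 : Real.exp (V a - E) / (n+1) * ((n+1) * |z - x0|^n) =
        |z - x0|^n * Real.exp (V a - E) := by field_simp
      rw [h3]
      gcongr
  · intro x hx y hy hxy
    have := diff_le_of_deriv F (fun x => (Real.exp (V a + E) / (n+1)) * P x) a d _ _ 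
      hF (fun x => (hPd x).const_mul _) ?_ x hx y hy hxy
    · linarith
    · intro z hz
      rw [hpe z hz, hu z hz]
      have h1 := abs_le.1 (hV' z hz)
      have h2 : Real.exp (V z) ≤ Real.exp (V a + E) := Real.exp_le_exp.2 (by linarith)
      have h3 : Real.exp (V a + E) / (n+1) * ((n+1) * |z - x0|^n) =
        |z - x0|^n * Real.exp (V a + E) := by field_simp
      rw [h3]
      gcongr

/-- reverse-Hoelder bound implies a crude cross-ratio bound -/
lemma cri_of_rh (F u : ℝ → ℝ) (K a b c d : ℝ) (hF : ∀ x, HasDerivAt F (u x) x)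
    (hmono : StrictMono F)
    (hab : a < b) (hbc : b < c) (hcd : c < d) (hK : 0 ≤ K)
    (h : ∀ x y z, a ≤ x → x < y → y ≤ d → z ∈ Set.Icc x y → u z * (y - x) ≤ K * (F y - F x)) :
    CRI F (K^2) a b c d := by
  have mv : ∀ x y, x < y → ∃ z ∈ Set.Ioo x y, F y - F x = u z * (y - x) := by
    intro x y hxy
    obtain ⟨z, hz, hz'⟩ := exists_hasDerivAt_eq_slope F u hxy
      (fun z _ => (hF z).continuousAt.continuousWithinAt) (fun z _ => hF z)
    refine ⟨z, hz, ?_⟩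
    rw [hz']
    field_simp [(sub_pos.2 hxy).ne']
  obtain ⟨z1, hz1, e1⟩ := mv a b hab
  obtain ⟨z2, hz2, e2⟩ := mv c d hcd
  have k1 := h a c z1 le_rfl (hab.trans hbc) hcd.le ⟨hz1.1.le, hz1.2.le.trans hbc.le⟩
  have k2 := h b d z2 hab.le (hbc.trans hcd) le_rfl ⟨hbc.le.trans hz2.1.le, hz2.2.le⟩
  unfold CRI
  have p1 : 0 ≤ F b - F a := sub_nonneg.2 (hmono hab).le
  have p2 : 0 ≤ F d - F c := sub_nonneg.2 (hmono hcd).le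
  have u1 : 0 ≤ u z1 := by
    by_contra hh
    nlinarith [mul_pos_of_neg_of_neg (not_le.1 hh) (show a - b < 0 by linarith)]
  have u2 : 0 ≤ u z2 := by
    by_contra hh
    nlinarith [mul_pos_of_neg_of_neg (not_le.1 hh) (show c - d < 0 by linarith)]
  have k3 : (u z1 * (c - a)) * (u z2 * (d - b)) ≤ (K * (F c - F a)) * (K * (F d - F b)) := by
    apply mul_le_mul k1 k2
    · exact mul_nonneg u2 (by linarith)
    · exact mul_nonneg hK (sub_nonneg.2 (hmono (hab.trans hbc)).le)
  have q : 0 ≤ (b - a) * (d - c) := mul_nonneg (by linarith) (by linarith)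
  have := mul_le_mul_of_nonneg_right k3 q
  rw [e1, e2]
  nlinarith

lemma quarter_pow (x0 x y z : ℝ) (n : ℕ) (hxy : x < y) (hz : z ∈ Set.Icc x y) :
    ∃ p, x ≤ p ∧ p + (y - x)/4 ≤ y ∧ ∀ w ∈ Set.Icc p (p + (y-x)/4),
      |z - x0|^n ≤ 2^n * |w - x0|^n := by
  suffices h : ∃ p, x ≤ p ∧ p + (y - x)/4 ≤ y ∧ ∀ w ∈ Set.Icc p (p + (y-x)/4),
      |z - x0| ≤ 2 * |w - x0| by
    obtain ⟨p, h1, h2, h3⟩ := h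
    refine ⟨p, h1, h2, fun w hw => ?_⟩
    rw [← mul_pow]
    exact pow_le_pow_left₀ (abs_nonneg _) (h3 w hw) n
  obtain ⟨hz1, hz2⟩ := hz
  rcases le_total (x0 - x) (y - x0) with h | h
  · refine ⟨y - (y-x)/4, by linarith, by linarith, fun w hw => ?_⟩
    obtain ⟨hw1, hw2⟩ := hw
    have : w - x0 ≤ |w - x0| := le_abs_self _
    rw [abs_le]
    constructor <;> linarith
  · refine ⟨x, by linarith, by linarith, fun w hw => ?_⟩
    obtain ⟨hw1, hw2⟩ := hw
    have : -(w - x0) ≤ |w - x0| := neg_le_abs _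
    rw [abs_le]
    constructor <;> linarith

lemma rh_local (F u V : ℝ → ℝ) (x0 L r: ℝ) (n : ℕ) (hF : ∀ x, HasDerivAt F (u x) x)
    (hmono : StrictMono F) (hL : 0 ≤ L)
    (hu : ∀ x ∈ Metric.ball x0 r, u x = |x - x0|^n * Real.exp (V x))
    (hV : ∀ x ∈ Metric.ball x0 r, ∀ y ∈ Metric.ball x0 r, |V x - V y| ≤ L * |x - y|)
    (x y z : ℝ) (hxy : x < y) (hz : z ∈ Set.Icc x y) (hx : x ∈ Metric.ball x0 r)
    (hy : y ∈ Metric.ball x0 r) :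
    u z * (y - x) ≤ (4 * 2^n * Real.exp (L * (2*r))) * (F y - F x) := by
  obtain ⟨p, hp1, hp2, hp3⟩ := quarter_pow x0 x y z n hxy hz
  have hb : ∀ w ∈ Set.Icc x y, w ∈ Metric.ball x0 r := by
    intro w hw
    rw [Real.ball_eq_Ioo] at *
    exact ⟨by linarith [hx.1, hw.1], by linarith [hy.2, hw.2]⟩
  have hlt : p < p + (y-x)/4 := by linarith
  obtain ⟨w, hw, hw'⟩ := exists_hasDerivAt_eq_slope F u hlt
      (fun z _ => (hF z).continuousAt.continuousWithinAt) (fun z _ => hF z)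
  have e1 : F (p + (y-x)/4) - F p = u w * ((y-x)/4) := by
    rw [hw', add_sub_cancel_left]
    have : (y - x) ≠ 0 := by linarith
    field_simp
  have e2 : F (p + (y-x)/4) ≤ F y := hmono.monotone hp2
  have e3 : F x ≤ F p := hmono.monotone hp1
  have hwI : w ∈ Set.Icc x y := ⟨by linarith [hw.1], by linarith [hw.2]⟩
  have hwb := hb w hwI
  have hzb := hb z hz
  have e4 : V z ≤ L * (2*r) + V w := by
    have h1 := hV z hzb w hwb
    have h2 : |z - w| ≤ 2 * r := by
      rw [Real.ball_eq_Ioo] at hwb hzb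
      rw [abs_le]
      constructor <;> linarith [hwb.1, hwb.2, hzb.1, hzb.2]
    have h3 := mul_le_mul_of_nonneg_left h2 hL
    have h4 := le_abs_self (V z - V w)
    linarith
  have e5 : u z ≤ 2^n * Real.exp (L*(2*r)) * u w := by
    rw [hu z hzb, hu w hwb]
    calc |z-x0|^n * Real.exp (V z) ≤ (2^n * |w-x0|^n) * Real.exp (L * (2*r) + V w) := by
          gcongr
          exact hp3 w ⟨hw.1.le, hw.2.le⟩
      _ = _ := by rw [Real.exp_add]; ring
  have e6 := mul_le_mul_of_nonneg_right e5 (show 0 ≤ y - x by linarith)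
  have e7 : u w * (y-x) ≤ 4 * (F y - F x) := by linarith
  have e8 := mul_le_mul_of_nonneg_left e7 (show 0 ≤ 2^n * Real.exp (L*(2*r)) by positivity)
  linarith

lemma local_form (F : ℝ → ℝ) (hA : ∀ x, AnalyticAt ℝ F x) (hmono : StrictMono F) (x0 : ℝ) :
    ∃ (r : ℝ) (n : ℕ) (V : ℝ → ℝ) (L : ℝ), 0 < r ∧ 0 ≤ L ∧
      (∀ x ∈ Metric.ball x0 r, deriv F x = |x - x0|^n * Real.exp (V x)) ∧
      (∀ x ∈ Metric.ball x0 r, ∀ y ∈ Metric.ball x0 r, |V x - V y| ≤ L * |x - y|) := by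
  have hd : AnalyticAt ℝ (deriv F) x0 := (hA x0).deriv
  have hnn : ∀ x, 0 ≤ deriv F x := fun x => hmono.monotone.deriv_nonneg
  have hnz : ¬ ∀ᶠ z in nhds x0, deriv F z = 0 := by
    intro h
    obtain ⟨r, hr, hb⟩ := Metric.eventually_nhds_iff_ball.1 h
    have hlt : x0 < x0 + r/2 := by linarith
    obtain ⟨z, hz, hz'⟩ := exists_deriv_eq_slope F hlt
      (fun z _ => (hA z).continuousAt.continuousWithinAt)
      (fun z _ => (hA z).differentiableAt.differentiableWithinAt)
    have h0 := hb z (by rw [Real.ball_eq_Ioo]; exact ⟨by linarith [hz.1], by linarith [hz.2]⟩)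
    rw [h0] at hz'
    have := hmono hlt
    have : 0 < (F (x0 + r/2) - F x0) / (x0 + r/2 - x0) := div_pos (by linarith) (by linarith)
    linarith
  obtain ⟨n, g, hg, hg0, hge⟩ := (hd.exists_eventuallyEq_pow_smul_nonzero_iff).2 hnz
  have hlog : ContDiffAt ℝ 1 (fun x => Real.log (g x)) x0 :=
    ContDiffAt.log hg.contDiffAt hg0
  obtain ⟨L, t, ht, hLip⟩ := hlog.exists_lipschitzOnWith
  have hgne : ∀ᶠ z in nhds x0, g z ≠ 0 := hg.continuousAt.eventually_ne hg0
  obtain ⟨r, hr, hb⟩ := Metric.eventually_nhds_iff_ball.1 (hge.and (hgne.and ht))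
  refine ⟨r, n, fun x => Real.log (g x), L, hr, L.2, ?_, ?_⟩
  · intro x hx
    obtain ⟨h1, h2, h3⟩ := hb x hx
    simp only
    rw [Real.exp_log_eq_abs h2, ← abs_pow, ← abs_mul, ← smul_eq_mul, ← h1, abs_of_nonneg (hnn x)]
  · intro x hx y hy
    have := hLip.dist_le_mul x (hb x hx).2.2 y (hb y hy).2.2
    simpa [Real.dist_eq] using this

lemma lift_int (F : ℝ → ℝ) (hlift : ∀ x : ℝ, F (x + 1) = F x + 1) (x : ℝ) (m : ℤ) :
    F (x + m) = F x + m := by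
  induction m using Int.induction_on generalizing x with
  | zero => simp
  | succ k ih =>
    have := hlift (x + k)
    push_cast at *
    rw [← add_assoc, this, ih]; ring
  | pred k ih =>
    have := hlift (x + (-(k:ℝ) - 1))
    push_cast at *
    have h2 := ih x
    have h3 : x + (-(k:ℝ) - 1) + 1 = x + -(k:ℝ) := by ring
    rw [h3] at this
    linarith

lemma deriv_int (F : ℝ → ℝ) (hlift : ∀ x : ℝ, F (x + 1) = F x + 1) (x : ℝ) (m : ℤ) :
    deriv F (x + m) = deriv F x := by
  have h : (fun y => F (y + m)) = fun y => F y + m := funext fun y => lift_int F hlift y m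
  have := deriv_comp_add_const F (m:ℝ) x
  rw [← this, h]
  simp

lemma cri_shift (F : ℝ → ℝ) (hlift : ∀ x : ℝ, F (x + 1) = F x + 1) (C a b c d : ℝ) (m : ℤ)
    (h : CRI F C (a + m) (b + m) (c + m) (d + m)) : CRI F C a b c d := by
  unfold CRI at *
  simp only [lift_int F hlift] at h
  simpa using h

lemma cri_global (F : ℝ → ℝ) (hA : ∀ x, AnalyticAt ℝ F x) (hmono : StrictMono F)
    (hlift : ∀ x : ℝ, F (x + 1) = F x + 1) :
    ∃ (δ K L : ℝ) (X : Finset ℝ), 0 < δ ∧ 1 ≤ K ∧ 0 ≤ L ∧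
      (∀ a b c d, a < b → b < c → c < d → d - a ≤ 1 → CRI F K a b c d) ∧
      (∀ a b c d, a < b → b < c → c < d → d - a < δ →
        (∀ x ∈ X, ∀ m : ℤ, ¬ (a < x + m ∧ x + m < d)) →
        CRI F (Real.exp (L * (d - a))) a b c d) := by
  choose r n V L hr hL hu hV using local_form F hA hmono
  have hnn : ∀ x, 0 ≤ deriv F x := fun x => hmono.monotone.deriv_nonneg
  have hF : ∀ x, HasDerivAt F (deriv F x) x := fun x => (hA x).differentiableAt.hasDerivAt
  obtain ⟨t, ht, hcov⟩ := (isCompact_Icc (a := (0:ℝ)) (b := 1)).elim_nhds_subcover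
    (fun x => Metric.ball x (r x)) (fun x _ => Metric.ball_mem_nhds x (hr x))
  obtain ⟨δ, hδ, hleb⟩ := lebesgue_number_lemma_of_metric
    (c := fun i : {x // x ∈ t} => Metric.ball i.1 (r i.1)) (isCompact_Icc (a := (0:ℝ)) (b := 1))
    (fun i => Metric.isOpen_ball) (by
      intro x hx
      obtain ⟨y, hy, hxy⟩ := Set.mem_iUnion₂.1 (hcov hx)
      exact Set.mem_iUnion.2 ⟨⟨y, hy⟩, hxy⟩)
  have hF0 : Continuous F := continuous_iff_continuousAt.2 fun x => (hA x).continuousAt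
  have hu0 : Continuous (deriv F) := continuous_iff_continuousAt.2 fun x => (hA x).deriv.continuousAt
  -- every short interval lies in a chart
  have chart : ∀ a d, a ≤ d → d - a < δ → ∃ m : ℤ, ∃ x ∈ t,
      ∀ w ∈ Set.Icc a d, w - m ∈ Metric.ball x (r x) := by
    intro a d had hd
    obtain ⟨i, hi⟩ := hleb (a - ⌊a⌋) ⟨by linarith [Int.floor_le a], by linarith [Int.lt_floor_add_one a]⟩
    refine ⟨⌊a⌋, i.1, i.2, fun w hw => hi ?_⟩
    rw [Metric.mem_ball, Real.dist_eq, abs_lt]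
    constructor <;> linarith [hw.1, hw.2]
  -- bounds
  obtain ⟨xm, -, hxm⟩ := (isCompact_Icc (a := (0:ℝ)) (b := 1)).exists_isMaxOn
    ⟨0, by simp⟩ hu0.continuousOn
  obtain ⟨ym, -, hym⟩ := (isCompact_Icc (a := (0:ℝ)) (b := 1)).exists_isMinOn
    ⟨0, by simp⟩ (f := fun x => F (x + δ) - F x) (by fun_prop)
  set U := deriv F xm with hU
  set η := F (ym + δ) - F ym with hη
  have hηpos : 0 < η := sub_pos.2 (hmono (by linarith))
  have fr : ∀ x : ℝ, x - ⌊x⌋ ∈ Set.Icc (0:ℝ) 1 := fun x =>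
    ⟨by linarith [Int.floor_le x], by linarith [Int.lt_floor_add_one x]⟩
  have hUb : ∀ x, deriv F x ≤ U := by
    intro x
    have h1 := hxm (fr x)
    have h2 := deriv_int F hlift (x - ⌊x⌋) ⌊x⌋
    rw [sub_add_cancel] at h2
    rw [h2]; exact h1
  have hηb : ∀ x, η ≤ F (x + δ) - F x := by
    intro x
    have h1 : η ≤ F (x - ⌊x⌋ + δ) - F (x - ⌊x⌋) := hym (fr x)
    have h2 := lift_int F hlift (x - ⌊x⌋) ⌊x⌋
    have h3 := lift_int F hlift (x - ⌊x⌋ + δ) ⌊x⌋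
    rw [sub_add_cancel] at h2
    rw [show x - ⌊x⌋ + δ + ⌊x⌋ = x + δ by ring] at h3
    rw [h2, h3]; linarith
  set k : ℝ → ℝ := fun x => 4 * 2^(n x) * Real.exp (L x * (2 * r x)) with hk
  have hkpos : ∀ x, 0 ≤ k x := fun x => by positivity
  set K0 := ∑ x ∈ t, k x + U / η + 1 with hK0
  have hU0 : 0 ≤ U := hnn xm
  have hS0 : 0 ≤ ∑ x ∈ t, k x := Finset.sum_nonneg fun x _ => hkpos x
  have hUη : 0 ≤ U/η := by positivity
  have rh : ∀ x y z, x < y → y - x ≤ 1 → z ∈ Set.Icc x y →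
      deriv F z * (y - x) ≤ K0 * (F y - F x) := by
    intro x y z hxy hy1 hz
    have hFxy : 0 < F y - F x := sub_pos.2 (hmono hxy)
    by_cases hlt : y - x < δ
    · obtain ⟨m, x0, hx0, hc⟩ := chart x y hxy.le hlt
      have := rh_local F (deriv F) (V x0) x0 (L x0) (r x0) (n x0) hF hmono (hL x0) (hu x0) (hV x0)
        (x - m) (y - m) (z - m) (by linarith) ⟨by linarith [hz.1], by linarith [hz.2]⟩
        (hc x ⟨le_rfl, hxy.le⟩) (hc y ⟨hxy.le, le_rfl⟩)
      have e1 := deriv_int F hlift (z - m) m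
      have e2 := lift_int F hlift (x - m) m
      have e3 := lift_int F hlift (y - m) m
      rw [sub_add_cancel] at e1 e2 e3
      rw [← e1, sub_sub_sub_cancel_right] at this
      have e4 : F (y - m) - F (x - m) = F y - F x := by linarith
      rw [e4] at this
      refine this.trans (mul_le_mul_of_nonneg_right ?_ hFxy.le)
      have : k x0 ≤ ∑ x ∈ t, k x := Finset.single_le_sum (fun x _ => hkpos x) hx0
      simp only [hk] at this hK0 hS0 ⊢
      linarith
    · have h1 : η ≤ F y - F x := (hηb x).trans (by
        have := hmono.monotone (show x + δ ≤ y by linarith)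
        linarith)
      have h2 : deriv F z * (y - x) ≤ U * 1 :=
        mul_le_mul (hUb z) hy1 (by linarith) hU0
      have h3 : U * 1 ≤ (U/η) * (F y - F x) := by
        rw [div_mul_eq_mul_div, le_div_iff₀ hηpos]
        nlinarith
      have h4 : (U/η) * (F y - F x) ≤ K0 * (F y - F x) :=
        mul_le_mul_of_nonneg_right (by linarith) hFxy.le
      linarith
  refine ⟨δ, K0^2, ∑ x ∈ t, 4 * L x, t, hδ, ?_, Finset.sum_nonneg fun x _ => by linarith [hL x],
    ?_, ?_⟩
  · nlinarith
  · intro a b c d hab hbc hcd hda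
    refine cri_of_rh F (deriv F) K0 a b c d hF hmono hab hbc hcd (by linarith) ?_
    intro x y z hx hxy hy hz
    exact rh x y z hxy (by linarith) hz
  · intro a b c d hab hbc hcd hda hX
    obtain ⟨m, x0, hx0, hc⟩ := chart a d (by linarith) hda
    have hin : ∀ w ∈ Set.Icc (a - m) (d - m), w ∈ Metric.ball x0 (r x0) := by
      intro w hw
      have := hc (w + m) ⟨by linarith [hw.1], by linarith [hw.2]⟩
      rwa [add_sub_cancel_right] at this
    have key := cri_local_good F (deriv F) (V x0) x0 (L x0) (n x0) hF (a - m) (b - m) (c - m) (d - m)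
      (by linarith) (by linarith) (by linarith) (hL x0) (fun x hx => hu x0 x (hin x hx))
      (fun x hx => hV x0 x (hin x hx) _ (hin _ ⟨le_rfl, by linarith⟩)) (by
        have := hX x0 hx0 m
        by_contra hh
        push Not at hh
        exact this ⟨by linarith, by linarith⟩)
    have key2 := cri_shift F hlift _ a b c d (-m) (by push_cast; simpa [sub_eq_add_neg] using key)
    unfold CRI at key2 ⊢
    refine key2.trans (mul_le_mul_of_nonneg_right ?_ ?_)
    · rw [Real.exp_le_exp, ← sub_eq_add_neg]
      refine mul_le_mul_of_nonneg_right ?_ (by linarith)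
      exact Finset.single_le_sum (f := fun x => 4 * L x) (fun x _ => by linarith [hL x]) hx0
    · have p1 := hmono (hab.trans hbc)
      have p2 := hmono (hbc.trans hcd)
      exact mul_nonneg (mul_nonneg (by linarith) (by linarith))
        (mul_nonneg (by linarith) (by linarith))

lemma sep_theta (θ c : ℝ) (hc : ∀ p : ℤ, ∀ q : ℕ, 0 < q →
      c / (q : ℝ) ^ 2 ≤ |θ - (p : ℝ) / (q : ℝ)|) (q : ℕ) (hq : 0 < q) (p : ℤ) :
    c / q ≤ |q * θ - p| := by
  have h := hc p q hq
  have hq' : (0:ℝ) < q := by exact_mod_cast hq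
  have e : q * θ - p = q * (θ - p / q) := by field_simp
  rw [e, abs_mul, abs_of_pos hq']
  calc c / q = q * (c / (q:ℝ)^2) := by field_simp
    _ ≤ _ := mul_le_mul_of_nonneg_left h hq'.le

lemma dense_theta (θ c : ℝ) (hc0 : 0 < c) (hc : ∀ p : ℤ, ∀ q : ℕ, 0 < q →
      c / (q : ℝ) ^ 2 ≤ |θ - (p : ℝ) / (q : ℝ)|) :
    ∃ C1 : ℝ, 0 < C1 ∧ ∀ S : ℝ, 0 < S → S ≤ 1 → ∃ q : ℕ, 0 < q ∧ q * S ≤ C1 ∧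
      ∀ y : ℝ, ∃ i < q, ∃ m : ℤ, |y - (i * θ + m)| ≤ S := by
  refine ⟨1/c + 2, by positivity, fun S hS hS1 => ?_⟩
  set Q : ℕ := ⌈(1/c + 1)/S⌉₊ with hQ
  have hQ1 : (1/c+1)/S ≤ Q := Nat.le_ceil _
  have hQ2 : (Q:ℝ) < (1/c+1)/S + 1 := Nat.ceil_lt_add_one (by positivity)
  have hQpos : 0 < Q := Nat.ceil_pos.2 (by positivity)
  obtain ⟨ρ, h1, h2⟩ := Real.exists_rat_abs_sub_le_and_den_le θ hQpos
  have hq : 0 < ρ.den := ρ.den_pos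
  have hq' : (0:ℝ) < ρ.den := by exact_mod_cast hq
  refine ⟨ρ.den, hq, ?_, ?_⟩
  · have : (ρ.den:ℝ) ≤ Q := by exact_mod_cast h2
    calc (ρ.den:ℝ) * S ≤ ((1/c+1)/S + 1) * S := by gcongr; linarith
      _ = 1/c + 1 + S := by field_simp
      _ ≤ _ := by linarith
  · intro y
    set q := ρ.den with hqd
    have hρ : (ρ:ℝ) = ρ.num / q := by
      exact Rat.cast_def ρ
    set k : ℤ := ⌊y * q⌋ with hk
    have hk1 : (k:ℝ) ≤ y * q := Int.floor_le _
    have hk2 : y * q < k + 1 := Int.lt_floor_add_one _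
    -- solve the congruence
    have hcop : IsCoprime ρ.num (q:ℤ) := by
      rw [Int.isCoprime_iff_gcd_eq_one]
      simpa [Int.gcd, hqd] using ρ.reduced
    obtain ⟨s, t, hst⟩ := hcop
    set i : ℤ := (s * k) % q with hi
    have hi0 : 0 ≤ i := Int.emod_nonneg _ (by omega)
    have hiq : i < q := Int.emod_lt_of_pos _ (by omega)
    obtain ⟨m, hm⟩ : ∃ m : ℤ, i * ρ.num = k - m * q := by
      refine ⟨t * k + ((s*k)/q) * ρ.num, ?_⟩
      have := Int.emod_add_mul_ediv (s*k) q
      rw [← hi] at this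
      have e : i = s*k - q * (s*k/q) := by linarith
      rw [e]
      linear_combination k * hst
    refine ⟨i.toNat, by omega, m, ?_⟩
    have hic : ((i.toNat : ℕ) : ℝ) = (i:ℝ) := by
      have : ((i.toNat : ℕ) : ℤ) = i := Int.toNat_of_nonneg hi0
      exact_mod_cast this
    rw [hic]
    have hm' : (i:ℝ) * ρ.num = k - m * q := by exact_mod_cast hm
    have e1 : (i:ℝ) * ρ = k/q - m := by
      rw [hρ, ← mul_div_assoc, hm']; field_simp
    have hi0' : (0:ℝ) ≤ i := by exact_mod_cast hi0
    have hiq' : (i:ℝ) ≤ q := by exact_mod_cast hiq.le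
    have hQp : (0:ℝ) < Q := by exact_mod_cast hQpos
    have e2 : |(i:ℝ) * (θ - ρ)| ≤ 1/(Q+1) := by
      rw [abs_mul, abs_of_nonneg hi0']
      calc (i:ℝ) * |θ - ρ| ≤ q * (1 / ((Q + 1) * q)) := by gcongr
        _ = _ := by field_simp
    have e3 : |y - k/q| ≤ 1/q := by
      have : y - k/q = (y*q - k)/q := by field_simp
      rw [this, abs_div, abs_of_pos hq', abs_of_nonneg (by linarith)]
      gcongr
      linarith
    have e4 : 1/(q:ℝ) ≤ 1/c * (1/(Q+1)) := by
      have := hc ρ.num q hq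
      rw [← hρ] at this
      have h3 := this.trans h1
      rw [div_le_div_iff₀ (by positivity) (by positivity)] at h3
      rw [one_div_mul_one_div, div_le_div_iff₀ (by positivity) (by positivity)]
      have : q * (c * (Q+1)) ≤ q * (q:ℝ) := by nlinarith
      have := le_of_mul_le_mul_left this hq'
      linarith
    have e5 : (1/c + 1) * (1/(Q+1)) ≤ S := by
      rw [mul_one_div, div_le_iff₀ (by positivity)]
      rw [div_le_iff₀ hS] at hQ1
      nlinarith
    have e6 : y - (i*θ + m) = (y - k/q) - i * (θ - ρ) := by
      rw [mul_sub, e1]; ring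
    rw [e6]
    calc _ ≤ |y - k/q| + |(i:ℝ) * (θ - ρ)| := abs_sub _ _
      _ ≤ 1/c * (1/(Q+1)) + 1/(Q+1) := by linarith
      _ ≤ S := by linarith

lemma card_sep (s : Finset ℕ) (p : ℕ → ℝ) (A l σ : ℝ) (hσ : 0 < σ) (hl : 0 ≤ l)
    (h1 : ∀ i ∈ s, A ≤ p i ∧ p i ≤ A + l)
    (h2 : ∀ i ∈ s, ∀ j ∈ s, i ≠ j → σ ≤ |p i - p j|) : (s.card : ℝ) ≤ l / σ + 1 := by
  have hinj : Set.InjOn (fun i => ⌊(p i - A)/σ⌋₊) s := by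
    intro i hi j hj hij
    by_contra hne
    have h := h2 i hi j hj hne
    have a1 : 0 ≤ (p i - A)/σ := div_nonneg (by linarith [(h1 i hi).1]) hσ.le
    have a2 : 0 ≤ (p j - A)/σ := div_nonneg (by linarith [(h1 j hj).1]) hσ.le
    have b1 := Nat.floor_le a1
    have b2 := Nat.floor_le a2
    have c1 := Nat.lt_floor_add_one ((p i - A)/σ)
    have c2 := Nat.lt_floor_add_one ((p j - A)/σ)
    simp only at hij
    rw [hij] at b1 c1
    have : |(p i - A)/σ - (p j - A)/σ| < 1 := by
      rw [abs_lt]; constructor <;> linarith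
    rw [← sub_div, abs_div, abs_of_pos hσ, div_lt_one hσ] at this
    rw [show p i - A - (p j - A) = p i - p j by ring] at this
    linarith
  have hcard : s.card ≤ (Finset.range (⌊l/σ⌋₊ + 1)).card := by
    apply Finset.card_le_card_of_injOn _ _ hinj
    intro i hi
    simp only [Finset.coe_range, Set.mem_Iio]
    apply Nat.lt_succ_of_le
    apply Nat.floor_le_floor
    gcongr
    linarith [(h1 i hi).2]
  rw [Finset.card_range] at hcard
  have h3 : (s.card:ℝ) ≤ ⌊l/σ⌋₊ + 1 := by exact_mod_cast hcard
  have := Nat.floor_le (show 0 ≤ l/σ by positivity)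
  linarith

open MeasureTheory Classical in
lemma sum_len_le (q : ℕ) (a d : ℕ → ℝ) (N : ℕ) (had : ∀ i < q, a i ≤ d i)
    (hlen : ∀ i < q, d i - a i ≤ 1)
    (hmult : ∀ y : ℝ, (Finset.card {i ∈ Finset.range q | ∃ m : ℤ, a i < y + m ∧ y + m < d i}) ≤ N) :
    ∑ i ∈ Finset.range q, (d i - a i) ≤ 2 * N := by
  let I : ℕ → Set ℝ := fun i => Set.Ioo (a i - ⌊a i⌋) (d i - ⌊a i⌋)
  have hpt : ∀ y : ℝ, ∑ i ∈ Finset.range q, (I i).indicator (fun _ => (1:ENNReal)) y ≤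
      (Set.Icc (0:ℝ) 2).indicator (fun _ => (N:ENNReal)) y := by
    intro y
    by_cases hy : y ∈ Set.Icc (0:ℝ) 2
    · rw [Set.indicator_of_mem hy]
      have : ∑ i ∈ Finset.range q, (I i).indicator (fun _ => (1:ENNReal)) y =
          ((Finset.card {i ∈ Finset.range q | y ∈ I i} : ℕ) : ENNReal) := by
        classical
        rw [Finset.card_filter]
        push_cast
        apply Finset.sum_congr rfl
        intro i _
        simp [Set.indicator_apply]
      rw [this]
      have h3 := hmult y
      have : (Finset.card {i ∈ Finset.range q | y ∈ I i}) ≤ N := by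
        refine le_trans (Finset.card_le_card ?_) h3
        intro i hi
        rw [Finset.mem_filter] at hi ⊢
        refine ⟨hi.1, ⌊a i⌋, ?_, ?_⟩
        · linarith [hi.2.1]
        · linarith [hi.2.2]
      exact_mod_cast this
    · rw [Set.indicator_of_notMem hy]
      apply le_of_eq
      apply Finset.sum_eq_zero
      intro i hi
      apply Set.indicator_of_notMem
      intro hyI
      apply hy
      have := hlen i (Finset.mem_range.1 hi)
      constructor
      · linarith [hyI.1, Int.floor_le (a i)]
      · linarith [hyI.2, Int.lt_floor_add_one (a i)]
  have h1 := lintegral_mono (μ := volume) hpt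
  rw [lintegral_finsetSum _ (fun i _ => Measurable.indicator measurable_const measurableSet_Ioo),
    lintegral_indicator_const measurableSet_Icc] at h1
  have h2 : ∀ i, ∫⁻ y, (I i).indicator (fun _ => (1:ENNReal)) y = ENNReal.ofReal (d i - a i) := by
    intro i
    rw [lintegral_indicator_const measurableSet_Ioo, Real.volume_Ioo, one_mul]
    congr 1; ring
  simp only [I] at h2
  simp only [h2] at h1
  rw [← ENNReal.ofReal_sum_of_nonneg, Real.volume_Icc] at h1
  · have h3 : (N:ENNReal) * ENNReal.ofReal (2 - 0) = ENNReal.ofReal (2 * N) := by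
      rw [← ENNReal.ofReal_natCast, ← ENNReal.ofReal_mul (by positivity)]
      congr 1; ring
    rw [h3] at h1
    exact (ENNReal.ofReal_le_ofReal_iff (by positivity)).1 h1
  · intro i hi
    linarith [had i (Finset.mem_range.1 hi)]

open Classical in
lemma sum_E_le (q : ℕ) (a d : ℕ → ℝ) (N : ℕ) (had : ∀ i < q, a i ≤ d i)
    (hlen : ∀ i < q, d i - a i ≤ 1)
    (hmult : ∀ y : ℝ, (Finset.card {i ∈ Finset.range q | ∃ m : ℤ, a i < y + m ∧ y + m < d i}) ≤ N)
    (X : Finset ℝ) (δ L k : ℝ) (hδ : 0 < δ) (hL : 0 ≤ L) (hk : 0 ≤ k) :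
    ∑ i ∈ Finset.range q, (L * (d i - a i) +
      if (δ ≤ d i - a i ∨ ∃ x ∈ X, ∃ m : ℤ, a i < x + m ∧ x + m < d i) then k else 0) ≤
    L * (2 * N) + k * (2 * N / δ + X.card * N) := by
  have hs := sum_len_le q a d N had hlen (by convert hmult)
  rw [Finset.sum_add_distrib, ← Finset.mul_sum]
  refine add_le_add (mul_le_mul_of_nonneg_left hs hL) ?_
  rw [← Finset.sum_filter, Finset.sum_const, nsmul_eq_mul, mul_comm]
  refine mul_le_mul_of_nonneg_left ?_ hk
  set B1 := {i ∈ Finset.range q | δ ≤ d i - a i} with hB1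
  set B2 : ℝ → Finset ℕ := fun x => {i ∈ Finset.range q | ∃ m : ℤ, a i < x + m ∧ x + m < d i} with hB2
  have h1 : (B1.card : ℝ) ≤ 2 * N / δ := by
    rw [le_div_iff₀ hδ]
    refine le_trans ?_ hs
    calc (B1.card:ℝ) * δ = ∑ i ∈ B1, δ := by rw [Finset.sum_const, nsmul_eq_mul]
      _ ≤ ∑ i ∈ B1, (d i - a i) := Finset.sum_le_sum fun i hi => (Finset.mem_filter.1 hi).2
      _ ≤ _ := Finset.sum_le_sum_of_subset_of_nonneg (Finset.filter_subset _ _) (fun i hi _ => by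
          linarith [had i (Finset.mem_range.1 hi)])
  have h2 : (X.biUnion B2).card ≤ X.card * N :=
    Finset.card_biUnion_le_card_mul X B2 N (fun x _ => hmult x)
  have h3 : (Finset.card {i ∈ Finset.range q | δ ≤ d i - a i ∨ ∃ x ∈ X, ∃ m : ℤ, a i < x + m ∧ x + m < d i})
      ≤ B1.card + (X.biUnion B2).card := by
    refine le_trans (Finset.card_le_card ?_) (Finset.card_union_le _ _)
    intro i hi
    obtain ⟨hi1, hi2⟩ := Finset.mem_filter.1 hi
    rcases hi2 with h | ⟨x, hx, h⟩
    · exact Finset.mem_union_left _ (Finset.mem_filter.2 ⟨hi1, h⟩)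
    · exact Finset.mem_union_right _ (Finset.mem_biUnion.2 ⟨x, hx, Finset.mem_filter.2 ⟨hi1, h⟩⟩)
  have h4 : ((Finset.card {i ∈ Finset.range q | δ ≤ d i - a i ∨ ∃ x ∈ X, ∃ m : ℤ, a i < x + m ∧ x + m < d i} : ℕ) : ℝ)
      ≤ B1.card + (X.card * N : ℕ) := by
    exact_mod_cast h3.trans (Nat.add_le_add_left h2 _)
  push_cast at h4
  linarith

lemma exists_semi (F : ℝ → ℝ) (θ : ℝ) (hF0 : Continuous F) (hmono : StrictMono F)
    (hlift : ∀ x : ℝ, F (x + 1) = F x + 1)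
    (hrot : ∀ x : ℝ, Filter.Tendsto (fun n : ℕ => F^[n] x / n) Filter.atTop (nhds θ))
    (hdense : ∀ S : ℝ, 0 < S → ∀ y : ℝ, ∃ i : ℕ, ∃ m : ℤ, |y - (i * θ + m)| < S) :
    ∃ h G : ℝ → ℝ, Monotone h ∧ Continuous h ∧ Function.Surjective h ∧
      (∀ x, h (x + 1) = h x + 1) ∧ (∀ x, h (F x) = h x + θ) ∧ (∀ x, F (G x) = x) := by
  let f : CircleDeg1Lift := ⟨⟨F, hmono.monotone⟩, hlift⟩
  have hfs : Function.Surjective F := by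
    apply hF0.surjective
    · exact f.tendsto_atTop
    · exact f.tendsto_atBot
  have hfb : Function.Bijective f := ⟨hmono.injective, hfs⟩
  have hτ : CircleDeg1Lift.translationNumber f = θ :=
    CircleDeg1Lift.translationNumber_eq_of_tendsto₀ f (hrot 0)
  obtain ⟨h, hh⟩ := CircleDeg1Lift.semiconj_of_isUnit_of_translationNumber_eq
    (CircleDeg1Lift.isUnit_iff_bijective.2 hfb)
    (CircleDeg1Lift.translate (Multiplicative.ofAdd θ)).isUnit
    (by rw [hτ, CircleDeg1Lift.translationNumber_translate])
  have hhF : ∀ x, h (F x) = h x + θ := by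
    intro x
    have := hh x
    rw [CircleDeg1Lift.translate_apply, add_comm] at this
    exact this
  have hh1 : ∀ x, h (x + 1) = h x + 1 := h.map_add_one
  have hit : ∀ i : ℕ, h (F^[i] 0) = h 0 + i * θ := by
    intro i
    induction i with
    | zero => simp
    | succ k ih => rw [Function.iterate_succ_apply', hhF, ih]; push_cast; ring
  have hcont : Continuous h := by
    apply h.monotone.continuous_of_denseRange
    rw [DenseRange, Metric.dense_iff]
    intro y S hS
    obtain ⟨i, m, him⟩ := hdense S hS (y - h 0)
    refine ⟨h (F^[i] 0 + m), ?_, ⟨_, rfl⟩⟩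
    rw [lift_int h hh1, hit, Metric.mem_ball, Real.dist_eq, abs_sub_comm]
    convert him using 2
    ring
  choose G hG using hfs
  exact ⟨h, G, h.monotone, hcont, hcont.surjective h.tendsto_atTop h.tendsto_atBot, hh1, hhF, hG⟩

lemma exists_min_pair (h : ℝ → ℝ) (hm : Monotone h) (hc : Continuous h)
    (hs : Function.Surjective h) (h1 : ∀ x, h (x + 1) = h x + 1) (S : ℝ) (hS : 0 < S) (hS1 : S < 1) :
    ∃ b c, h c - h b = S ∧ ∀ b' c', h c' - h b' = S → c - b ≤ c' - b' := by
  let T : Set (ℝ × ℝ) := {p | h p.2 - h p.1 = S} ∩ (Set.Icc 0 1 ×ˢ Set.Icc 0 2)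
  have hT : IsCompact T := by
    apply IsCompact.inter_left (isCompact_Icc.prod isCompact_Icc)
    exact isClosed_eq (by fun_prop) continuous_const
  have hlt : ∀ b c, h c - h b = S → b < c ∧ c < b + 1 := by
    intro b c hbc
    constructor
    · by_contra hh
      have := hm (not_lt.1 hh); linarith
    · by_contra hh
      have := hm (not_lt.1 hh); rw [h1] at this; linarith
  have hin : ∀ b c, h c - h b = S → (b - ⌊b⌋, c - ⌊b⌋) ∈ T := by
    intro b c hbc
    have e1 := lift_int h h1 (b - ⌊b⌋) ⌊b⌋
    have e2 := lift_int h h1 (c - ⌊b⌋) ⌊b⌋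
    rw [sub_add_cancel] at e1 e2
    obtain ⟨g1, g2⟩ := hlt b c hbc
    have f1 := Int.floor_le b
    have f2 := Int.lt_floor_add_one b
    refine ⟨?_, ⟨by simp only; linarith, by simp only; linarith⟩, ⟨by simp only; linarith, by simp only; linarith⟩⟩
    show h (c - ⌊b⌋) - h (b - ⌊b⌋) = S
    linarith
  obtain ⟨c0, hc0⟩ := hs (h 0 + S)
  obtain ⟨p, hp, hpm⟩ := hT.exists_isMinOn ⟨_, hin 0 c0 (by linarith)⟩
    (f := fun p : ℝ × ℝ => p.2 - p.1) (by fun_prop)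
  refine ⟨p.1, p.2, hp.1, fun b' c' hb => ?_⟩
  have : p.2 - p.1 ≤ (c' - ⌊b'⌋) - (b' - ⌊b'⌋) := hpm (hin b' c' hb)
  linarith
lemma quad_arith {ε a b c d : ℝ} (he : 0 < ε) (i1 : a < b) (i2 : b < c) (i3 : c < d)
    (hfin : ε ≤ (b - a) * (d - c) / ((c - a) * (d - b))) :
    ε * (c - b) ≤ b - a ∧ ε * (c - b) ≤ d - c := by
  rw [le_div_iff₀ (mul_pos (by linarith) (by linarith))] at hfin
  constructor
  · have g1 : (b - a) * (d - c) ≤ (b - a) * (d - b) :=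
      mul_le_mul_of_nonneg_left (by linarith) (by linarith)
    have g2 : ε * (c - a) * (d - b) ≤ (b - a) * (d - b) := by
      rw [mul_assoc]; exact hfin.trans g1
    have g3 := le_of_mul_le_mul_right g2 (by linarith)
    have g4 : ε * (c - b) ≤ ε * (c - a) := mul_le_mul_of_nonneg_left (by linarith) he.le
    exact g4.trans g3
  · have g1 : (b - a) * (d - c) ≤ (c - a) * (d - c) :=
      mul_le_mul_of_nonneg_right (by linarith) (by linarith)
    have g2 : (c - a) * (ε * (d - b)) ≤ (c - a) * (d - c) := by
      rw [mul_left_comm]; exact hfin.trans g1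
    have g3 := le_of_mul_le_mul_left g2 (by linarith)
    have g4 : ε * (c - b) ≤ ε * (d - b) := mul_le_mul_of_nonneg_left (by linarith) he.le
    exact g4.trans g3


lemma cr_step (F : ℝ → ℝ) (C a b c d : ℝ) (hC : CRI F C a b c d) (hmono : StrictMono F)
    (hab : a < b) (hbc : b < c) (hcd : c < d) :
    (F b - F a) * (F d - F c) / ((F c - F a) * (F d - F b)) ≤
      C * ((b - a) * (d - c) / ((c - a) * (d - b))) := by
  unfold CRI at hC
  have p1 : 0 < (F c - F a) * (F d - F b) :=
    mul_pos (sub_pos.2 (hmono (hab.trans hbc))) (sub_pos.2 (hmono (hbc.trans hcd)))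
  have p2 : 0 < (c - a) * (d - b) := mul_pos (by linarith) (by linarith)
  rw [← mul_div_assoc, div_le_div_iff₀ p1 p2]
  linarith

open Classical in
lemma good_quad (F h G : ℝ → ℝ) (θ c : ℝ) (hA : ∀ x, AnalyticAt ℝ F x) (hmono : StrictMono F)
    (hlift : ∀ x : ℝ, F (x + 1) = F x + 1) (hc0 : 0 < c)
    (hbd : ∀ p : ℤ, ∀ q : ℕ, 0 < q → c / (q : ℝ) ^ 2 ≤ |θ - (p : ℝ) / (q : ℝ)|)
    (hm : Monotone h) (hc : Continuous h)
    (hs : Function.Surjective h) (h1 : ∀ x, h (x + 1) = h x + 1)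
    (hF : ∀ x, h (F x) = h x + θ) (hG : ∀ x, F (G x) = x) :
    ∃ ε > 0, ∀ S, 0 < S → S < 1/4 → ∀ y, ∃ a b c d, |h b - y| ≤ S/8 ∧ h b - h a = S ∧
      h c - h b = S ∧ h d - h c = S ∧ ε * (c - b) ≤ b - a ∧ ε * (c - b) ≤ d - c := by
  obtain ⟨δ, K, L, X, hδ, hK, hL, hbad, hgood⟩ := cri_global F hA hmono hlift
  obtain ⟨C1, hC1, hdense⟩ := dense_theta θ c hc0 hbd
  set N : ℕ := ⌈24 * C1 / c + 1⌉₊ with hN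
  have hk : 0 ≤ Real.log K := Real.log_nonneg hK
  set T := L * (2 * N) + Real.log K * (2 * N / δ + X.card * N) with hT
  refine ⟨Real.exp (-T) / 4, by positivity, fun S hS hS4 y => ?_⟩
  obtain ⟨b0, c0, hbc0, hmin⟩ := exists_min_pair h hm hc hs h1 S hS (by linarith)
  obtain ⟨a0, ha0⟩ := hs (h b0 - S)
  obtain ⟨d0, hd0⟩ := hs (h c0 + S)
  have hlt : ∀ {x y}, h x < h y → x < y := fun {x y} hxy => by
    by_contra hh
    exact absurd (hm (not_lt.1 hh)) (not_le.2 hxy)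
  have hGm : StrictMono G := by
    intro x y hxy
    rw [← hmono.lt_iff_lt, hG, hG]; exact hxy
  have hGh : ∀ i : ℕ, ∀ x, h (G^[i] x) = h x - i * θ := by
    intro i x
    induction i with
    | zero => simp
    | succ k ih =>
      have := hF (G (G^[k] x))
      rw [hG] at this
      rw [Function.iterate_succ_apply']
      push_cast
      linarith
  have oab : a0 < b0 := hlt (by linarith)
  have obc : b0 < c0 := hlt (by linarith)
  have ocd : c0 < d0 := hlt (by linarith)
  have Gab : ∀ i : ℕ, G^[i] a0 < G^[i] b0 := fun i => hGm.iterate i oab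
  have Gbc : ∀ i : ℕ, G^[i] b0 < G^[i] c0 := fun i => hGm.iterate i obc
  have Gcd : ∀ i : ℕ, G^[i] c0 < G^[i] d0 := fun i => hGm.iterate i ocd
  have Glen : ∀ i : ℕ, G^[i] d0 - G^[i] a0 ≤ 1 := by
    intro i
    have : G^[i] d0 < G^[i] a0 + 1 := hlt (by rw [h1, hGh, hGh]; linarith)
    linarith
  obtain ⟨q, hq, hqS, hqd⟩ := hdense (S/8) (by linarith) (by linarith)
  have hq' : (0:ℝ) < q := by exact_mod_cast hq
  -- multiplicity
  have hmult : ∀ y : ℝ, (Finset.card {i ∈ Finset.range q |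
      ∃ m : ℤ, G^[i] a0 < y + m ∧ y + m < G^[i] d0}) ≤ N := by
    intro y
    set s := {i ∈ Finset.range q | ∃ m : ℤ, G^[i] a0 < y + m ∧ y + m < G^[i] d0} with hsd
    have hex : ∀ i, ∃ m : ℤ, i ∈ s → G^[i] a0 < y + m ∧ y + m < G^[i] d0 := by
      intro i
      by_cases hi : i ∈ s
      · obtain ⟨m, hm⟩ := (Finset.mem_filter.1 hi).2
        exact ⟨m, fun _ => hm⟩
      · exact ⟨0, fun h => absurd h hi⟩
    choose m hm' using hex
    have key := card_sep s (fun i => h y + m i + i * θ) (h a0) (3*S) (c/q) (by positivity)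
      (by linarith) ?_ ?_
    · have : 3 * S / (c/q) + 1 ≤ 24 * C1 / c + 1 := by
        have : 3 * S / (c/q) = 24 * (q * (S/8)) / c := by field_simp; norm_num
        rw [this]
        gcongr
      have h3 : (s.card:ℝ) ≤ N := (key.trans this).trans (Nat.le_ceil _)
      exact_mod_cast h3
    · intro i hi
      obtain ⟨g1, g2⟩ := hm' i hi
      have g3 := hm g1.le
      have g4 := hm g2.le
      rw [lift_int h h1, hGh] at g3 g4
      constructor <;> linarith
    · have wlog_lt : ∀ i ∈ s, ∀ j ∈ s, i < j → c/q ≤ |(h y + m i + i * θ) - (h y + m j + j * θ)| := by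
        intro i hi j hj hij
        have hjq : j < q := Finset.mem_range.1 (Finset.mem_filter.1 hj).1
        have g := sep_theta θ c hbd (j - i) (by omega) (m i - m j)
        have e : ((j - i : ℕ) : ℝ) = j - i := by push_cast [hij.le]; ring
        have hpos : (0:ℝ) < ((j - i : ℕ) : ℝ) := by
          have : 0 < j - i := by omega
          exact_mod_cast this
        have hle : ((j - i : ℕ) : ℝ) ≤ q := by
          have : j - i ≤ q := by omega
          exact_mod_cast this
        have g2 : c / q ≤ c / ((j - i : ℕ) : ℝ) := by gcongr
        refine (g2.trans g).trans (le_of_eq ?_)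
        rw [e, abs_sub_comm]
        push_cast
        congr 1
        ring
      intro i hi j hj hij
      rcases lt_or_gt_of_ne hij with hh | hh
      · exact wlog_lt i hi j hj hh
      · have := wlog_lt j hj i hi hh
        rwa [abs_sub_comm] at this
  -- distortion
  have hsum := sum_E_le q (fun i => G^[i] a0) (fun i => G^[i] d0) N
    (fun i _ => ((Gab i).trans ((Gbc i).trans (Gcd i))).le) (fun i _ => Glen i)
    (by convert hmult) X δ L (Real.log K) hδ hL hk
  rw [← hT] at hsum
  set E : ℕ → ℝ := fun i => L * (G^[i] d0 - G^[i] a0) +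
      if (δ ≤ G^[i] d0 - G^[i] a0 ∨ ∃ x ∈ X, ∃ m : ℤ, G^[i] a0 < x + m ∧ x + m < G^[i] d0)
      then Real.log K else 0 with hE
  have hE0 : ∀ i, 0 ≤ E i := by
    intro i
    simp only [hE]
    refine add_nonneg (mul_nonneg hL (by linarith [Gab i, Gbc i, Gcd i])) ?_
    split_ifs <;> simp [hk]
  have hcri : ∀ i, CRI F (Real.exp (E i)) (G^[i] a0) (G^[i] b0) (G^[i] c0) (G^[i] d0) := by
    intro i
    simp only [hE]
    split_ifs with hb
    · have g := hbad _ _ _ _ (Gab i) (Gbc i) (Gcd i) (Glen i)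
      unfold CRI at g ⊢
      refine g.trans (mul_le_mul_of_nonneg_right ?_ ?_)
      · rw [Real.exp_add, Real.exp_log (by linarith)]
        have : 1 ≤ Real.exp (L * (G^[i] d0 - G^[i] a0)) :=
          Real.one_le_exp (mul_nonneg hL (by linarith [Gab i, Gbc i, Gcd i]))
        nlinarith
      · have p1 := hmono ((Gab i).trans (Gbc i))
        have p2 := hmono ((Gbc i).trans (Gcd i))
        exact mul_nonneg (mul_nonneg (by linarith) (by linarith))
          (mul_nonneg (by linarith [Gab i]) (by linarith [Gcd i]))
    · push Not at hb
      rw [add_zero]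
      refine hgood _ _ _ _ (Gab i) (Gbc i) (Gcd i) hb.1 ?_
      rintro x hx m ⟨g1, g2⟩
      exact absurd g2 (not_lt.2 (hb.2 x hx m g1))
  set R : ℕ → ℝ := fun i => (G^[i] b0 - G^[i] a0) * (G^[i] d0 - G^[i] c0) /
    ((G^[i] c0 - G^[i] a0) * (G^[i] d0 - G^[i] b0)) with hR
  have hRpos : ∀ i, 0 < R i := by
    intro i
    have := Gab i
    have := Gbc i
    have := Gcd i
    exact div_pos (mul_pos (by linarith) (by linarith)) (mul_pos (by linarith) (by linarith))
  have hRstep : ∀ i, R i ≤ Real.exp (E (i+1)) * R (i+1) := by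
    intro i
    have := cr_step F _ _ _ _ _ (hcri (i+1)) hmono (Gab (i+1)) (Gbc (i+1)) (Gcd (i+1))
    have e : ∀ x, F (G^[i+1] x) = G^[i] x := fun x => by
      rw [Function.iterate_succ_apply', hG]
    rw [e, e, e, e] at this
    exact this
  have hRi : ∀ i, R 0 ≤ Real.exp (∑ j ∈ Finset.range (i+1), E j) * R i := by
    intro i
    induction i with
    | zero =>
      have : 1 ≤ Real.exp (∑ j ∈ Finset.range (0+1), E j) := 
        Real.one_le_exp (by simpa using hE0 0)
      nlinarith [hRpos 0]
    | succ k ih =>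
      rw [Finset.sum_range_succ, Real.exp_add, mul_assoc]
      exact ih.trans (mul_le_mul_of_nonneg_left (hRstep k) (Real.exp_pos _).le)
  have hR0 : 1/4 ≤ R 0 := by
    have m1 := hmin a0 b0 (by linarith)
    have m2 := hmin c0 d0 (by linarith)
    simp only [hR, Function.iterate_zero, id]
    rw [div_le_div_iff₀ (by norm_num) (mul_pos (by linarith) (by linarith))]
    have := mul_le_mul (show c0 - a0 ≤ 2 * (b0 - a0) by linarith)
      (show d0 - b0 ≤ 2 * (d0 - c0) by linarith) (by linarith) (by linarith)
    linarith
  obtain ⟨i, hi, m, him⟩ := hqd (h b0 - y)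
  have hfin : Real.exp (-T) / 4 ≤ R i := by
    have g1 : ∑ j ∈ Finset.range (i+1), E j ≤ T := by
      refine le_trans ?_ hsum
      exact Finset.sum_le_sum_of_subset_of_nonneg (by
        intro j hj
        rw [Finset.mem_range] at *
        omega) (fun j _ _ => hE0 j)
    have g2 := hRi i
    have g3 : Real.exp (∑ j ∈ Finset.range (i+1), E j) ≤ Real.exp T := Real.exp_le_exp.2 g1
    have g4 : 1/4 ≤ Real.exp T * R i :=
      hR0.trans (g2.trans (mul_le_mul_of_nonneg_right g3 (hRpos i).le))
    have g5 := mul_le_mul_of_nonneg_left g4 (Real.exp_pos (-T)).le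
    rw [← mul_assoc, ← Real.exp_add] at g5
    simp at g5
    linarith
  set ε := Real.exp (-T) / 4 with hε
  have hεpos : 0 < ε := by positivity
  clear_value ε
  have i1 := Gab i
  have i2 := Gbc i
  have i3 := Gcd i
  simp only [hR] at hfin
  have hsh : ∀ x, h (x - m) = h x - m := fun x => by
    have e := lift_int h h1 x (-m)
    push_cast at e
    rw [sub_eq_add_neg x (m:ℝ), e]
    ring
  obtain ⟨f1, f2⟩ := quad_arith hεpos i1 i2 i3 hfin
  refine ⟨G^[i] a0 - m, G^[i] b0 - m, G^[i] c0 - m, G^[i] d0 - m, ?_, ?_, ?_, ?_, ?_, ?_⟩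
  · rw [hsh, hGh]
    convert him using 2
    ring
  · rw [hsh, hsh, hGh, hGh]
    linarith
  · rw [hsh, hsh, hGh, hGh]
    linarith
  · rw [hsh, hsh, hGh, hGh]
    linarith
  · rw [sub_sub_sub_cancel_right, sub_sub_sub_cancel_right]
    exact f1
  · rw [sub_sub_sub_cancel_right, sub_sub_sub_cancel_right]
    exact f2


lemma doubling_left (h : ℝ → ℝ) (hm : Monotone h) (hs : Function.Surjective h) (ε : ℝ) (hε : 0 < ε)
    (hg : ∀ S, 0 < S → S < 1/4 → ∀ y, ∃ b c d, |h c - y| ≤ S/8 ∧ 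
      h c - h b = S ∧ h d - h c = S ∧ ε * (c - b) ≤ d - c) :
    ∃ K : ℝ, 1 < K ∧ ∀ x y z, h x < h y → h y - h x < 1/5 → h x - (h y - h x) ≤ h z →
      y - z ≤ K * (y - x) := by
  have hlt : ∀ {x y}, h x < h y → x < y := fun {x y} hxy => by
    by_contra hh
    exact absurd (hm (not_lt.1 hh)) (not_le.2 hxy)
  set k := 1 + 1/ε with hk
  have hk1 : 1 < k := by
    have : 0 < 1/ε := by positivity
    linarith
  have step : ∀ x y z, h x < h y → h y - h x < 3/8 → h x - (h y - h x)/3 ≤ h z →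
      y - z ≤ k * (y - x) := by
    intro x y z hxy hs1 hz
    set s := h y - h x with hsd
    obtain ⟨b, c, d, g1, g2, g3, g4⟩ := hg (2*s/3) (by linarith) (by linarith) (h x + (2*s/3)/4)
    obtain ⟨g5, g6⟩ := abs_le.1 g1
    have l1 : x < c := hlt (by linarith)
    have l2 : b < z := hlt (by linarith)
    have l3 : d < y := hlt (by linarith)
    have g7 : c - b ≤ (1/ε) * (d - c) := by
      rw [one_div, inv_mul_eq_div, le_div_iff₀ hε]; linarith
    have g8 : (1/ε) * (d - c) ≤ (1/ε) * (y - x) := by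
      apply mul_le_mul_of_nonneg_left _ (by positivity); linarith
    rw [hk]
    linarith
  refine ⟨k^3, by nlinarith [mul_pos (sub_pos.2 hk1) (sub_pos.2 hk1)], ?_⟩
  intro x y z hxy hs1 hz
  set s := h y - h x with hsd
  obtain ⟨z1, hz1⟩ := hs (h x - s/3)
  obtain ⟨z2, hz2⟩ := hs (h x - 2*s/3)
  have s1 := step x y z1 hxy (by linarith) (by linarith)
  have s2 := step z1 y z2 (by linarith) (by linarith) (by linarith)
  have s3 := step z2 y z (by linarith) (by linarith) (by linarith)
  calc y - z ≤ k * (y - z2) := s3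
    _ ≤ k * (k * (y - z1)) := by gcongr
    _ ≤ k * (k * (k * (y - x))) := by gcongr
    _ = _ := by ring

lemma doubling_measure (h : ℝ → ℝ) (hm : Monotone h) (hs : Function.Surjective h)
    (h1 : ∀ x, h (x + 1) = h x + 1) (ε : ℝ) (hε : 0 < ε)
    (hg : ∀ S, 0 < S → S < 1/4 → ∀ y, ∃ b c d, |h c - y| ≤ S/8 ∧ 
      h c - h b = S ∧ h d - h c = S ∧ ε * (c - b) ≤ d - c) :
    ∃ H : ℝ, 1 ≤ H ∧ ∀ x t, 0 < t → h (x + t) - h x ≤ H * (h x - h (x - t)) := by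
  obtain ⟨K, hK, hd⟩ := doubling_left h hm hs ε hε hg
  have hlt : ∀ {x y}, h x < h y → x < y := fun {x y} hxy => by
    by_contra hh
    exact absurd (hm (not_lt.1 hh)) (not_le.2 hxy)
  have hK0 : 0 < K := by linarith
  set κ := 1 - 1/K with hκ
  have hκ0 : 0 ≤ κ := by
    have : 1/K ≤ 1 := by rw [div_le_one hK0]; exact hK.le
    linarith
  have hκ1 : κ < 1 := by
    have : 0 < 1/K := by positivity
    linarith
  obtain ⟨J, hJ⟩ := exists_pow_lt_of_lt_one (show 0 < 1/K by positivity) hκ1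
  have h2J : (1:ℝ) ≤ 2^J := one_le_pow₀ (by norm_num)
  refine ⟨5 * 2^J, by linarith, fun x t ht => ?_⟩
  have ha0 : 0 ≤ h x - h (x - t) := sub_nonneg.2 (hm (by linarith))
  have hb0 : 0 ≤ h (x + t) - h x := sub_nonneg.2 (hm (by linarith))
  rcases le_or_gt t 1 with ht1 | ht1
  · by_contra hcon
    push Not at hcon
    set α := h x - h (x - t) with hα
    set β := h (x + t) - h x with hβ
    have hβ1 : β ≤ 1 := by
      have := hm (show x + t ≤ x + 1 by linarith)
      rw [h1] at this
      linarith
    -- choose a slightly larger mass 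
    have hαβ : α < β / (5 * 2^J) := by
      rw [lt_div_iff₀ (by positivity)]; linarith
    obtain ⟨α', ha1, ha2⟩ := exists_between hαβ
    rw [lt_div_iff₀ (by positivity)] at ha2
    have hα' : 0 < α' := by linarith
    obtain ⟨xm, hxm⟩ := hs (h x - α')
    have hxm' : xm < x - t := hlt (by linarith)
    choose y hy using fun j : ℕ => hs (h x + 2^j * α')
    have hpow : ∀ j ≤ J, (2:ℝ)^j * α' < 1/5 := by
      intro j hj
      have : (2:ℝ)^j * α' ≤ 2^J * α' := by
        gcongr
        norm_num
      nlinarith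
    have hyJ : y J < x + t := hlt (by rw [hy]; nlinarith)
    have y0 : t < K * (y 0 - x) := by
      have e := hy 0
      rw [pow_zero, one_mul] at e
      have p := hpow 0 (Nat.zero_le _)
      rw [pow_zero, one_mul] at p
      have g := hd x (y 0) xm (by linarith) (by linarith) (by linarith)
      have : x < y 0 := hlt (by linarith)
      linarith
    have ys : ∀ j < J, y j - x ≤ κ * (y (j+1) - x) := by
      intro j hj
      have e1 := hy j
      have e2 := hy (j+1)
      rw [pow_succ] at e2
      have p := hpow j hj.le
      have p2 : 0 < (2:ℝ)^j * α' := by positivity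
      have g := hd (y j) (y (j+1)) x (by linarith) (by linarith) (by linarith)
      have : (1/K) * (y (j+1) - x) ≤ y (j+1) - y j := by
        rw [one_div, inv_mul_eq_div, div_le_iff₀ hK0]; linarith
      rw [hκ]
      linarith
    have yj : ∀ j ≤ J, y 0 - x ≤ κ^j * (y j - x) := by
      intro j
      induction j with
      | zero => intro _; simp
      | succ k ih =>
        intro hk
        calc y 0 - x ≤ κ^k * (y k - x) := ih (by omega)
          _ ≤ κ^k * (κ * (y (k+1) - x)) := by
            apply mul_le_mul_of_nonneg_left (ys k (by omega)) (by positivity)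
          _ = _ := by ring
    have f1 := yj J le_rfl
    have f2 : κ^J * (y J - x) ≤ κ^J * t := mul_le_mul_of_nonneg_left (by linarith) (by positivity)
    have f3 : κ^J * t < 1/K * t := mul_lt_mul_of_pos_right hJ ht
    have f4 : y 0 - x < 1/K * t := by linarith
    have f5 := mul_lt_mul_of_pos_left f4 hK0
    rw [← mul_assoc, mul_one_div_cancel hK0.ne', one_mul] at f5
    linarith
  · have e1 : (⌊t⌋ : ℝ) ≤ h x - h (x - t) := by
      have := hm (show x - t ≤ x + ((-⌊t⌋ : ℤ) : ℝ) by push_cast; linarith [Int.floor_le t])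
      rw [lift_int h h1] at this
      push_cast at this
      linarith
    have e2 : h (x + t) - h x ≤ ⌊t⌋ + 1 := by
      have := hm (show x + t ≤ x + ((⌊t⌋ + 1 : ℤ) : ℝ) by push_cast; linarith [Int.lt_floor_add_one t])
      rw [lift_int h h1] at this
      push_cast at this
      linarith
    have e3 : (1:ℝ) ≤ ⌊t⌋ := by
      have : (1:ℤ) ≤ ⌊t⌋ := Int.le_floor.2 (by push_cast; linarith)
      exact_mod_cast this
    have e4 : 1 * (h x - h (x-t)) ≤ 2^J * (h x - h (x - t)) := mul_le_mul_of_nonneg_right h2J ha0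
    linarith

theorem quasisymmetric_linearization_bounded_type
    (F : ℝ → ℝ) (θ : ℝ)
    (hA : ∀ x : ℝ, AnalyticAt ℝ F x)
    (hmono : StrictMono F)
    (hlift : ∀ x : ℝ, F (x + 1) = F x + 1)
    (hrot : ∀ x : ℝ, Filter.Tendsto (fun n : ℕ => F^[n] x / n) Filter.atTop (nhds θ))
    (hbdd : ∃ c > (0 : ℝ), ∀ p : ℤ, ∀ q : ℕ, 0 < q →
      c / (q : ℝ) ^ 2 ≤ |θ - (p : ℝ) / (q : ℝ)|) :
    ∃ h : ℝ → ℝ, ∃ H : ℝ, 1 ≤ H ∧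
      StrictMono h ∧ Continuous h ∧ Function.Surjective h ∧
      (∀ x : ℝ, h (x + 1) = h x + 1) ∧
      (∀ x : ℝ, h (F x) = h x + θ) ∧
      (∀ x : ℝ, ∀ t : ℝ, 0 < t →
        H⁻¹ ≤ (h (x + t) - h x) / (h x - h (x - t)) ∧
        (h (x + t) - h x) / (h x - h (x - t)) ≤ H) := by
  obtain ⟨c, hc0, hbd⟩ := hbdd
  obtain ⟨h, G, hm, hc, hs, h1, hF, hG⟩ := exists_semi F θ
    (continuous_iff_continuousAt.2 fun x => (hA x).continuousAt) hmono hlift hrot (by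
      obtain ⟨C1, hC1, hd⟩ := dense_theta θ c hc0 hbd
      intro S hS y
      obtain ⟨q, -, -, hq⟩ := hd (min (S/2) 1) (by positivity) (min_le_right _ _)
      obtain ⟨i, -, m, him⟩ := hq y
      exact ⟨i, m, him.trans_lt ((min_le_left _ _).trans_lt (by linarith))⟩)
  obtain ⟨ε, hε, hquad⟩ := good_quad F h G θ c hA hmono hlift hc0 hbd hm hc hs h1 hF hG
  obtain ⟨H1, hH1, D1⟩ := doubling_measure h hm hs h1 ε hε (by
    intro S hS hS4 y
    obtain ⟨a, b, c, d, g1, g2, g3, g4, g5, g6⟩ := hquad S hS hS4 (y - S)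
    refine ⟨b, c, d, ?_, g3, g4, g6⟩
    rwa [show h c - y = h b - (y - S) by linarith])
  obtain ⟨H2, hH2, D2⟩ := doubling_measure (fun x => -h (-x)) 
    (fun x y hxy => neg_le_neg (hm (neg_le_neg hxy)))
    (fun y => by obtain ⟨x, hx⟩ := hs (-y); exact ⟨-x, by simp [hx]⟩)
    (fun x => by
      have := h1 (-(x+1))
      rw [show -(x+1) + 1 = -x by ring] at this
      show -h (-(x+1)) = -h (-x) + 1
      linarith) ε hε (by
    intro S hS hS4 y
    obtain ⟨a, b, c, d, g1, g2, g3, g4, g5, g6⟩ := hquad S hS hS4 (-y)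
    refine ⟨-c, -b, -a, ?_, ?_, ?_, ?_⟩
    · simp only [neg_neg]
      rw [← abs_neg]
      rwa [show -(-h b - y) = h b - -y by ring]
    · simp only [neg_neg]; linarith
    · simp only [neg_neg]; linarith
    · linarith)
  have D2' : ∀ x t, 0 < t → h x - h (x - t) ≤ H2 * (h (x + t) - h x) := by
    intro x t ht
    have := D2 (-x) t ht
    simp only [neg_neg, neg_add_rev, neg_sub] at this
    rw [show -t + x = x - t by ring, show t - -x = x + t by ring] at this
    linarith
  have hpos : ∀ x t, 0 < t → 0 < h x - h (x - t) := by
    intro x t ht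
    by_contra hcon
    have h0 : h x - h (x - t) = 0 :=
      le_antisymm (not_lt.1 hcon) (sub_nonneg.2 (hm (by linarith)))
    have hn : ∀ n : ℕ, h (x + n * t) - h (x + n * t - t) = 0 := by
      intro n
      induction n with
      | zero => simpa using h0
      | succ k ih =>
        have g := D1 (x + k * t) t ht
        rw [ih, mul_zero] at g
        have e : x + ((k+1 : ℕ) : ℝ) * t = x + k * t + t := by push_cast; ring
        rw [e, add_sub_cancel_right]
        have := hm (show x + k * t ≤ x + k*t + t by linarith)
        linarith
    have hn' : ∀ n : ℕ, h (x + n * t) = h x := by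
      intro n
      induction n with
      | zero => simp
      | succ k ih =>
        have g := hn (k+1)
        have e : x + ((k+1 : ℕ) : ℝ) * t = x + k * t + t := by push_cast; ring
        rw [e, add_sub_cancel_right] at g
        rw [e]
        linarith
    obtain ⟨n, hn1⟩ := exists_nat_ge (1/t)
    rw [div_le_iff₀ ht] at hn1
    have := hm (show x + 1 ≤ x + n * t by linarith)
    rw [hn', h1] at this
    linarith
  refine ⟨h, max H1 H2, hH1.trans (le_max_left _ _), ?_, hc, hs, h1, hF, ?_⟩
  · intro x y hxy
    have := hpos y (y - x) (by linarith)
    rw [sub_sub_cancel] at this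
    linarith
  · intro x t ht
    have p1 := hpos x t ht
    have p2 : 0 < h (x + t) - h x := by
      have := hpos (x + t) t ht
      rwa [add_sub_cancel_right] at this
    have hH0 : 0 < max H1 H2 := lt_of_lt_of_le (by linarith) (le_max_left H1 H2)
    constructor
    · rw [le_div_iff₀ p1, inv_mul_eq_div, div_le_iff₀ hH0]
      have g1 := D2' x t ht
      have g2 := mul_le_mul_of_nonneg_right (le_max_right H1 H2) p2.le
      linarith
    · rw [div_le_iff₀ p1]
      exact (D1 x t ht).trans (mul_le_mul_of_nonneg_right (le_max_left _ _) p1.le)
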